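/- Let n ≥ 1, 0 < p ≤ 1 and m ∈ ℕ₀. There exists a constant C > 0 such that for every harmonic function f on ℝ^{n+1}_+ and every z ∈ ℝ^{n+1}_+: ( ∫_{ℝ^{n+1}_+} |f(w)| |Q_m(z,w)| s^m dy ds )^p ≤ C ∫_{ℝ^{n+1}_+} |f(w)|^p s^{mp+(n+1)(p−1)} |z − w̄|^{−p(m+n+1)} dy ds, where w = (y,s). -/

import Mathlib

open MeasureTheory Real Set
open scoped ENNReal

noncomputable section

abbrev Euc (N : ℕ) : Type := EuclideanSpace ℝ (Fin N)

/-- The point `(x, t) ∈ ℝ^{n+1}`. -/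
def pt {n : ℕ} (x : Euc n) (t : ℝ) : Euc (n + 1) :=
  (EuclideanSpace.equiv (Fin (n + 1)) ℝ).symm (Fin.snoc (fun i => x i) t)

/-- horizontal part of a point of ℝ^{n+1} -/
def xp {n : ℕ} (z : Euc (n + 1)) : Euc n :=
  (EuclideanSpace.equiv (Fin n) ℝ).symm (fun i => z i.castSucc)

/-- vertical part of a point of ℝ^{n+1} -/
def tp {n : ℕ} (z : Euc (n + 1)) : ℝ := z (Fin.last n)

/-- The upper half space ℝ^{n+1}_+. -/
def upperHS (n : ℕ) : Set (Euc (n + 1)) := {z | 0 < tp z}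

/-- |z - w̄| where z = (x,t), w̄ = (y, -s): Euclidean distance -/
def dB {n : ℕ} (x : Euc n) (t : ℝ) (y : Euc n) (s : ℝ) : ℝ :=
  dist (pt x t) (pt y (-s))

/-- the measure t^λ dx dt on ℝ^n × (0,∞), identified with ℝ^{n+1}_+ -/
def mLam (n : ℕ) (l : ℝ) : Measure (Euc n × ℝ) :=
  ((volume : Measure (Euc n)).prod ((volume : Measure ℝ).restrict (Ioi 0))).withDensity
    (fun zt => ENNReal.ofReal (zt.2 ^ l))

/-- second derivative of `f` at `z` along direction `v` -/
def d2 {V : Type*} [NormedAddCommGroup V] [NormedSpace ℝ V] (f : V → ℝ) (z v : V) : ℝ :=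
  iteratedFDeriv ℝ 2 f z ![v, v]

/-- `f` is harmonic on a subset of ℝ^N : twice continuously differentiable with
vanishing Laplacian. -/
def HarmonicOnE {N : ℕ} (f : Euc N → ℝ) (s : Set (Euc N)) : Prop :=
  ContDiffOn ℝ 2 f s ∧ ∀ z ∈ s, ∑ i, d2 f z (EuclideanSpace.single i 1) = 0

/-- `f` is harmonic on (ℝ^{n+1}_+)^m, viewed as an open subset of ℝ^{m(n+1)}. -/
def HarmonicOnM {n m : ℕ} (f : (Fin m → Euc (n + 1)) → ℝ) : Prop :=
  ContDiffOn ℝ 2 f {z | ∀ j, z j ∈ upperHS n} ∧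
  ∀ z ∈ {z : Fin m → Euc (n + 1) | ∀ j, z j ∈ upperHS n},
    ∑ j, ∑ i, d2 f z (Function.update (0 : Fin m → Euc (n + 1)) j (EuclideanSpace.single i 1)) = 0

/-- `f` is harmonic in each variable separately on (ℝ^{n+1}_+)^m -/
def HarmonicSep {n m : ℕ} (f : (Fin m → Euc (n + 1)) → ℝ) : Prop :=
  ∀ (j : Fin m) (z : Fin m → Euc (n + 1)), (∀ k, z k ∈ upperHS n) →
    HarmonicOnE (fun w => f (Function.update z j w)) (upperHS n)

/-- the closed cube centered at (y,s) with side length s -/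
def Qcube {n : ℕ} (y : Euc n) (s : ℝ) : Set (Euc (n + 1)) :=
  {z | (∀ i : Fin n, |z (Fin.castSucc i) - y i| ≤ s / 2) ∧ |tp z - s| ≤ s / 2}

/-- the A^p_λ (quasi)-norm, raised to the power p -/
def normAp (n : ℕ) (f : Euc (n + 1) → ℝ) (p l : ℝ) : ℝ≥0∞ :=
  ∫⁻ zt : Euc n × ℝ, ENNReal.ofReal (|f (pt zt.1 zt.2)| ^ p) ∂(mLam n l)

/-- membership in the harmonic Bergman space A^p_λ -/
def memAp (n : ℕ) (f : Euc (n + 1) → ℝ) (p l : ℝ) : Prop :=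
  HarmonicOnE f (upperHS n) ∧ normAp n f p l < ⊤

/-- Lebesgue measure dy ds on ℝ^n × (0,∞) -/
def baseM (n : ℕ) : Measure (Euc n × ℝ) :=
  (volume : Measure (Euc n)).prod ((volume : Measure ℝ).restrict (Ioi 0))

/-- the standard normalizing constant of the Poisson kernel for ℝ^{n+1}_+ -/
def cP (n : ℕ) : ℝ := Real.Gamma (((n : ℝ) + 1) / 2) / Real.pi ^ (((n : ℝ) + 1) / 2)

/-- the Poisson kernel P(x,t) = c_n t (|x|² + t²)^{-(n+1)/2} for ℝ^{n+1}_+ -/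
def Pker (n : ℕ) (x : Euc n) (t : ℝ) : ℝ :=
  cP n * t / (‖x‖ ^ 2 + t ^ 2) ^ (((n : ℝ) + 1) / 2)

/-- the harmonic Bergman kernel Q_m(z,w), z = (x,t), w = (y,s) -/
def Qker (n m : ℕ) (x : Euc n) (t : ℝ) (y : Euc n) (s : ℝ) : ℝ :=
  ((-2 : ℝ) ^ (m + 1) / (Nat.factorial m : ℝ)) *
    iteratedDeriv (m + 1) (fun u => Pker n (x - y) u) (t + s)

theorem abs_iteratedDeriv_pow_mul_rpow_le (k : ℕ) : ∀ (a : ℕ) (b : ℝ),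
    ∃ C : ℝ, 0 < C ∧ ∀ A : ℝ, 0 ≤ A → ∀ t : ℝ, 0 < t →
      |iteratedDeriv k (fun u : ℝ => u ^ a * (A + u ^ 2) ^ (-b)) t| ≤
        C * (A + t ^ 2) ^ (((a : ℝ) - k) / 2 - b) := by
  induction k with
  | zero =>
    intro a b
    refine ⟨1, one_pos, fun A hA t ht => ?_⟩
    have hρ : 0 < A + t ^ 2 := by positivity
    have h1 : t ^ a ≤ (A + t ^ 2) ^ ((a : ℝ) / 2) := by
      calc t ^ a = (t ^ 2) ^ ((a : ℝ) / 2) := by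
            rw [← Real.rpow_natCast t 2, ← Real.rpow_mul ht.le, ← Real.rpow_natCast]
            congr 1; push_cast; ring
        _ ≤ _ := Real.rpow_le_rpow (by positivity) (by linarith) (by positivity)
    rw [iteratedDeriv_zero, abs_of_nonneg (by positivity), one_mul, Nat.cast_zero, sub_zero,
      sub_eq_add_neg, Real.rpow_add hρ]
    exact mul_le_mul_of_nonneg_right h1 (by positivity)
  | succ k ih =>
    intro a b
    obtain ⟨C₁, hC₁, h₁⟩ := ih (a - 1) b
    obtain ⟨C₂, hC₂, h₂⟩ := ih (a + 1) (b + 1)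
    refine ⟨a * C₁ + 2 * |b| * C₂ + 1, by positivity, fun A hA t ht => ?_⟩
    have hρ : 0 < A + t ^ 2 := by positivity
    have hsm : ∀ (c : ℕ) (d : ℝ), ContDiffAt ℝ k (fun u : ℝ => u ^ c * (A + u ^ 2) ^ (-d)) t := by
      intro c d
      refine ContDiffAt.mul (by fun_prop) (ContDiffAt.rpow_const_of_ne (by fun_prop) hρ.ne')
    have hd : deriv (fun u : ℝ => u ^ a * (A + u ^ 2) ^ (-b)) =ᶠ[nhds t]
        ((fun u => (a : ℝ) * (u ^ (a - 1) * (A + u ^ 2) ^ (-b))) +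
          (fun u => (-2 * b) * (u ^ (a + 1) * (A + u ^ 2) ^ (-(b + 1))))) := by
      filter_upwards [lt_mem_nhds ht] with u hu
      have hρu : 0 < A + u ^ 2 := by positivity
      have e1 : HasDerivAt (fun u : ℝ => A + u ^ 2) (2 * u) u := by
        simpa using (hasDerivAt_pow 2 u).const_add A
      have e2 := (hasDerivAt_pow a u).mul (e1.rpow_const (p := -b) (Or.inl hρu.ne'))
      have e3 := e2.deriv
      rw [show (fun u : ℝ => u ^ a * (A + u ^ 2) ^ (-b)) =
        ((fun x : ℝ => x ^ a) * fun y => (A + y ^ 2) ^ (-b)) from rfl, e3]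
      simp only [Pi.add_apply]
      rw [show -(b + 1) = -b - 1 by ring]
      ring
    have hb1 := h₁ A hA t ht
    have hb2 := h₂ A hA t ht
    rw [iteratedDeriv_succ', hd.iteratedDeriv_eq,
      iteratedDeriv_add (contDiffAt_const.mul (hsm _ _)) (contDiffAt_const.mul (hsm _ _)),
      iteratedDeriv_const_mul_field, iteratedDeriv_const_mul_field]
    set X := (A + t ^ 2) ^ (((a : ℝ) - (k + 1 : ℕ)) / 2 - b) with hX
    have hX0 : 0 < X := by positivity
    have i2 : (A + t ^ 2) ^ (((a + 1 : ℕ) - (k : ℝ)) / 2 - (b + 1)) = X := by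
      rw [hX]; congr 1; push_cast; ring
    rw [i2] at hb2
    have i1 : (a : ℝ) * |iteratedDeriv k (fun u : ℝ => u ^ (a - 1) * (A + u ^ 2) ^ (-b)) t| ≤
        a * (C₁ * X) := by
      rcases Nat.eq_zero_or_pos a with h0 | h0
      · simp [h0]
      · have : (A + t ^ 2) ^ (((a - 1 : ℕ) - (k : ℝ)) / 2 - b) = X := by
          rw [hX]; congr 1; push_cast [Nat.cast_sub h0]; ring
        rw [this] at hb1
        exact mul_le_mul_of_nonneg_left hb1 (by positivity)
    refine (abs_add_le _ _).trans ?_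
    rw [abs_mul, abs_mul, Nat.abs_cast, abs_mul, abs_neg, abs_two]
    have i3 := mul_le_mul_of_nonneg_left hb2 (show 0 ≤ 2 * |b| by positivity)
    nlinarith

theorem dB_sq {n : ℕ} (x : Euc n) (t : ℝ) (y : Euc n) (s : ℝ) :
    dB x t y s ^ 2 = ‖x - y‖ ^ 2 + (t + s) ^ 2 := by
  rw [dB, EuclideanSpace.dist_eq, Real.sq_sqrt (Finset.sum_nonneg fun _ _ => sq_nonneg _),
    Fin.sum_univ_castSucc, ← dist_eq_norm, EuclideanSpace.dist_eq,
    Real.sq_sqrt (Finset.sum_nonneg fun _ _ => sq_nonneg _)]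
  simp [pt, Real.dist_eq, sq_abs]

theorem dB_nonneg {n : ℕ} (x : Euc n) (t : ℝ) (y : Euc n) (s : ℝ) : 0 ≤ dB x t y s := dist_nonneg

theorem add_le_dB {n : ℕ} (x : Euc n) (t : ℝ) (y : Euc n) (s : ℝ) : t + s ≤ dB x t y s := by
  refine (abs_le_of_sq_le_sq' ?_ (dB_nonneg ..)).2
  rw [dB_sq]
  nlinarith [sq_nonneg ‖x - y‖]

theorem exists_abs_Qker_le (n m : ℕ) : ∃ C : ℝ, 0 < C ∧
    ∀ (x : Euc n) (t : ℝ) (y : Euc n) (s : ℝ), 0 < t → 0 < s →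
      |Qker n m x t y s| ≤ C * dB x t y s ^ (-((m : ℝ) + n + 1)) := by
  obtain ⟨C, hC, h⟩ := abs_iteratedDeriv_pow_mul_rpow_le (m + 1) 1 (((n : ℝ) + 1) / 2)
  refine ⟨|(-2 : ℝ) ^ (m + 1) / (Nat.factorial m : ℝ)| * (|cP n| * C) + 1, by positivity,
    fun x t y s ht hs => ?_⟩
  have e : (fun u => Pker n (x - y) u) = fun u : ℝ =>
      cP n * (u ^ 1 * (‖x - y‖ ^ 2 + u ^ 2) ^ (-(((n : ℝ) + 1) / 2))) := by
    funext u
    rw [Pker, Real.rpow_neg (by positivity)]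
    ring
  have h1 := h (‖x - y‖ ^ 2) (by positivity) (t + s) (by positivity)
  rw [← dB_sq, ← Real.rpow_natCast (dB x t y s) 2, ← Real.rpow_mul (dB_nonneg ..)] at h1
  rw [show ((2 : ℕ) : ℝ) * (((1 : ℕ) - ((m + 1 : ℕ) : ℝ)) / 2 - ((n : ℝ) + 1) / 2) =
    -((m : ℝ) + n + 1) by push_cast; ring] at h1
  have hX : 0 ≤ dB x t y s ^ (-((m : ℝ) + n + 1)) := Real.rpow_nonneg (dB_nonneg ..) _
  rw [Qker, e, iteratedDeriv_const_mul_field, abs_mul, abs_mul, add_mul, one_mul]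
  refine le_add_of_le_of_nonneg ?_ hX
  rw [mul_assoc, mul_assoc]
  gcongr

theorem measurePreserving_pt (n : ℕ) :
    MeasurePreserving (fun w : Euc n × ℝ => pt w.1 w.2)
      ((volume : Measure (Euc n)).prod (volume : Measure ℝ)) volume := by
  have h1 : MeasurePreserving (fun w : Euc n × ℝ => (WithLp.ofLp w.1, w.2))
      ((volume : Measure (Euc n)).prod (volume : Measure ℝ))
      ((volume : Measure (Fin n → ℝ)).prod (volume : Measure ℝ)) :=
    (PiLp.volume_preserving_ofLp (Fin n)).prod (MeasurePreserving.id _)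
  have h2 := (Measure.measurePreserving_swap
    (μ := (volume : Measure (Fin n → ℝ))) (ν := (volume : Measure ℝ)))
  have h3 := (volume_preserving_piFinSuccAbove (fun _ : Fin (n + 1) => ℝ) (Fin.last n)).symm
  have h4 := (PiLp.volume_preserving_toLp (Fin (n + 1)))
  have h5 := h4.comp (h3.comp (h2.comp h1))
  refine (congrArg (fun F => MeasurePreserving F _ _) ?_).mp h5
  funext w
  ext i
  refine Fin.lastCases ?_ (fun j => ?_) i
  · simp [pt, MeasurableEquiv.piFinSuccAbove, Fin.insertNthEquiv, Fin.insertNth_last']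
  · simp [pt, MeasurableEquiv.piFinSuccAbove, Fin.insertNthEquiv, Fin.insertNth_last']

theorem measurableEmbedding_pt (n : ℕ) :
    MeasurableEmbedding (fun w : Euc n × ℝ => pt w.1 w.2) := by
  have hc : Continuous (fun w : Euc n × ℝ => pt w.1 w.2) := by
    unfold pt
    refine (ContinuousLinearEquiv.continuous _).comp (continuous_pi fun i => ?_)
    refine Fin.lastCases ?_ (fun j => ?_) i
    · simpa using continuous_snd
    · simp only [Fin.snoc_castSucc]; fun_prop
  refine hc.measurableEmbedding ?_
  rintro ⟨a, s⟩ ⟨b, t⟩ h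
  have h' : ∀ i, pt a s i = pt b t i := fun i => by rw [show pt a s = pt b t from h]
  refine Prod.ext ?_ ?_
  · ext i; simpa [pt] using h' i.castSucc
  · simpa [pt] using h' (Fin.last n)

@[simp] theorem tp_pt {n : ℕ} (x : Euc n) (t : ℝ) : tp (pt x t) = t := by simp [tp, pt]

theorem continuous_tp (n : ℕ) : Continuous (tp : Euc (n + 1) → ℝ) := by
  unfold tp; fun_prop

theorem isOpen_upperHS (n : ℕ) : IsOpen (upperHS n) :=
  isOpen_lt continuous_const (continuous_tp n)

theorem lintegral_baseM (n : ℕ) (g : Euc (n + 1) → ℝ≥0∞) :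
    ∫⁻ w, g (pt w.1 w.2) ∂(baseM n) = ∫⁻ z in upperHS n, g z := by
  rw [← (measurePreserving_pt n).setLIntegral_comp_preimage_emb (measurableEmbedding_pt n) g]
  congr 1
  rw [baseM, ← Measure.restrict_univ (μ := (volume : Measure (Euc n))), Measure.prod_restrict,
    Measure.restrict_univ]
  congr 1
  ext w
  simp [upperHS]

/-- The compactly supported `C¹` radial weight `(1 - |y|²)₊²`. -/
def bump {N : ℕ} (y : Euc N) : ℝ := max (1 - ‖y‖ ^ 2) 0 ^ 2

theorem continuous_bump {N : ℕ} : Continuous (bump (N := N)) := by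
  unfold bump; fun_prop

theorem bump_nonneg {N : ℕ} (y : Euc N) : 0 ≤ bump y := by unfold bump; positivity

theorem bump_le_one {N : ℕ} (y : Euc N) : bump y ≤ 1 := by
  unfold bump
  refine pow_le_one₀ (le_max_right _ _) (max_le ?_ zero_le_one)
  nlinarith [sq_nonneg ‖y‖]

theorem max_one_sub_norm_sq_eq_zero {N : ℕ} {y : Euc N} (hy : 1 ≤ ‖y‖) :
    max (1 - ‖y‖ ^ 2) 0 = 0 := max_eq_right (by nlinarith)

theorem hasCompactSupport_of_norm {N : ℕ} {g : Euc N → ℝ} (h : ∀ y, 1 ≤ ‖y‖ → g y = 0) :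
    HasCompactSupport g := by
  refine HasCompactSupport.intro (isCompact_closedBall (0 : Euc N) 1) fun y hy => h y ?_
  simp only [Metric.mem_closedBall, dist_zero_right, not_le] at hy
  exact hy.le

theorem hasDerivAt_max_cube (u : ℝ) :
    HasDerivAt (fun v : ℝ => max v 0 ^ 3) (3 * max u 0 ^ 2) u := by
  rcases lt_trichotomy u 0 with h | h | h
  · have : (fun v : ℝ => max v 0 ^ 3) =ᶠ[nhds u] fun _ => 0 := by
      filter_upwards [gt_mem_nhds h] with v hv
      rw [max_eq_right hv.le]; norm_num
    rw [max_eq_right h.le]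
    simpa using (hasDerivAt_const u (0 : ℝ)).congr_of_eventuallyEq this
  · subst h
    rw [hasDerivAt_iff_isLittleO]
    simp only [max_self, sub_zero, ne_eq, OfNat.ofNat_ne_zero, not_false_eq_true, zero_pow,
      mul_zero, smul_zero]
    have h1 : (fun v : ℝ => max v 0 ^ 3) =O[nhds 0] fun v : ℝ => v ^ 3 := by
      refine Asymptotics.IsBigO.of_bound 1 (Filter.Eventually.of_forall fun v => ?_)
      rw [norm_pow, norm_pow, one_mul]
      refine pow_le_pow_left₀ (norm_nonneg _) ?_ 3
      rw [Real.norm_eq_abs, Real.norm_eq_abs, abs_of_nonneg (le_max_right _ _)]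
      exact max_le (le_abs_self v) (abs_nonneg v)
    refine h1.trans_isLittleO ?_
    simpa using Asymptotics.isLittleO_pow_id (𝕜 := ℝ) (n := 3) (by norm_num)
  · have : (fun v : ℝ => max v 0 ^ 3) =ᶠ[nhds u] fun v => v ^ 3 := by
      filter_upwards [lt_mem_nhds h] with v hv
      rw [max_eq_left hv.le]
    rw [max_eq_left h.le]
    simpa using (hasDerivAt_pow 3 u).congr_of_eventuallyEq this

theorem hasFDerivAt_max_cube {N : ℕ} (y : Euc N) :
    HasFDerivAt (fun v : Euc N => max (1 - ‖v‖ ^ 2) 0 ^ 3)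
      ((-6 * bump y) • innerSL ℝ y) y := by
  have h1 : HasFDerivAt (fun v : Euc N => 1 - ‖v‖ ^ 2) (-(2 • innerSL ℝ y)) y :=
    (hasStrictFDerivAt_norm_sq y).hasFDerivAt.const_sub 1
  have h2 := (hasDerivAt_max_cube (1 - ‖y‖ ^ 2)).comp_hasFDerivAt y h1
  refine h2.congr_fderiv ?_
  ext v
  simp [bump]
  ring

theorem integral_bump_pos {N : ℕ} : 0 < ∫ y : Euc N, bump y := by
  refine continuous_bump.integral_pos_of_hasCompactSupport_nonneg_nonzero
    (hasCompactSupport_of_norm fun y hy => ?_) bump_nonneg (x := 0) ?_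
  · rw [bump, max_one_sub_norm_sq_eq_zero hy]; norm_num
  · simp [bump]

/-- Integration against the radial weight kills the radial derivative of a harmonic function. -/
theorem integral_bump_mul_fderiv_eq_zero {N : ℕ} {G : Euc N → ℝ} (hG : ContDiff ℝ 2 G)
    (hL : ∀ y : Euc N, ‖y‖ < 1 → ∑ i, d2 G y (EuclideanSpace.single i 1) = 0) :
    ∫ y : Euc N, bump y * fderiv ℝ G y y = 0 := by
  set ψ : Euc N → ℝ := fun v => max (1 - ‖v‖ ^ 2) 0 ^ 3 with hψ
  have hψc : Continuous ψ := by rw [hψ]; fun_prop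
  have hψ0 : ∀ y, 1 ≤ ‖y‖ → ψ y = 0 := fun y hy => by
    simp only [hψ]; rw [max_one_sub_norm_sq_eq_zero hy]; norm_num
  have hb0 : ∀ y : Euc N, 1 ≤ ‖y‖ → bump y = 0 := fun y hy => by
    rw [bump, max_one_sub_norm_sq_eq_zero hy]; norm_num
  have h_int : ∀ g : Euc N → ℝ, Continuous g → (∀ y, 1 ≤ ‖y‖ → g y = 0) → Integrable g :=
    fun g hg h => hg.integrable_of_hasCompactSupport (hasCompactSupport_of_norm h)
  have hG1 : ContDiff ℝ 1 (fderiv ℝ G) := hG.fderiv_right (by norm_num)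
  let e : Fin N → Euc N := fun i => EuclideanSpace.single i 1
  have hGi : ∀ i, ContDiff ℝ 1 (fun y => fderiv ℝ G y (e i)) := fun i => hG1.clm_apply contDiff_const
  have hψd : ∀ y, fderiv ℝ ψ y = (-6 * bump y) • innerSL ℝ y :=
    fun y => (hasFDerivAt_max_cube y).fderiv
  have hψi : ∀ i y, fderiv ℝ ψ y (e i) = -6 * bump y * y i := fun i y => by
    rw [hψd]; simp [e, EuclideanSpace.inner_single_right]
  have hd2 : ∀ i y, fderiv ℝ (fun y => fderiv ℝ G y (e i)) y (e i) = d2 G y (e i) := fun i y => by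
    rw [d2, iteratedFDeriv_two_apply,
      fderiv_clm_apply (hG1.differentiable one_ne_zero y) (differentiableAt_const _)]
    simp
  have hcd2 : ∀ i, Continuous (fun y => fderiv ℝ (fun y => fderiv ℝ G y (e i)) y (e i)) :=
    fun i => ((hGi i).continuous_fderiv one_ne_zero).clm_apply continuous_const
  have hby : ∀ i, Continuous fun y : Euc N => -6 * bump y * y i := fun i =>
    (continuous_const.mul continuous_bump).mul (by fun_prop)
  have I1 : ∀ i, Integrable fun y : Euc N => -6 * bump y * y i * fderiv ℝ G y (e i) := fun i =>
    h_int _ ((hby i).mul (hGi i).continuous) fun y hy => by simp [hb0 y hy]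
  have I2 : ∀ i, Integrable fun y : Euc N =>
      ψ y * fderiv ℝ (fun y => fderiv ℝ G y (e i)) y (e i) := fun i =>
    h_int _ (hψc.mul (hcd2 i)) fun y hy => by simp [hψ0 y hy]
  have ibp : ∀ i, ∫ y, ψ y * fderiv ℝ (fun y => fderiv ℝ G y (e i)) y (e i) =
      - ∫ y : Euc N, -6 * bump y * y i * fderiv ℝ G y (e i) := fun i => by
    have := integral_mul_fderiv_eq_neg_fderiv_mul_of_integrable (μ := (volume : Measure (Euc N)))
      (f := ψ) (g := fun y => fderiv ℝ G y (e i)) (v := e i)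
      (by simpa only [hψi] using I1 i) (I2 i)
      (h_int _ (hψc.mul (hGi i).continuous) fun y hy => by simp [hψ0 y hy])
      (fun x _ => (hasFDerivAt_max_cube x).differentiableAt)
      (fun x _ => (hGi i).differentiable one_ne_zero x)
    simpa only [hψi] using this
  have key : ∀ y : Euc N, bump y * fderiv ℝ G y y =
      (-1 / 6) * ∑ i, -6 * bump y * y i * fderiv ℝ G y (e i) := fun y => by
    have hy : fderiv ℝ G y y = ∑ i, y i * fderiv ℝ G y (e i) := by
      have hs : ∑ i, y i • e i = y := by
        simpa [e] using (EuclideanSpace.basisFun (Fin N) ℝ).sum_repr y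
      calc fderiv ℝ G y y = fderiv ℝ G y (∑ i, y i • e i) := by rw [hs]
        _ = _ := by simp
    rw [hy, Finset.mul_sum, Finset.mul_sum]
    exact Finset.sum_congr rfl fun i _ => by ring
  simp_rw [key]
  rw [integral_const_mul, integral_finsetSum _ fun i _ => I1 i]
  have : ∑ i, ∫ y : Euc N, -6 * bump y * y i * fderiv ℝ G y (e i) =
      - ∫ y, ∑ i, ψ y * fderiv ℝ (fun y => fderiv ℝ G y (e i)) y (e i) := by
    rw [integral_finsetSum _ fun i _ => I2 i, ← Finset.sum_neg_distrib]
    exact Finset.sum_congr rfl fun i _ => by rw [ibp i, neg_neg]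
  rw [this]
  have hz : ∀ y, ∑ i, ψ y * fderiv ℝ (fun y => fderiv ℝ G y (e i)) y (e i) = 0 := fun y => by
    rw [← Finset.mul_sum]
    rcases lt_or_ge ‖y‖ 1 with h | h
    · simp_rw [hd2]
      rw [hL y h, mul_zero]
    · rw [hψ0 y h, zero_mul]
  simp [hz]

theorem hasFDerivAt_comp_add_smul {N : ℕ} {W : Type*} [NormedAddCommGroup W] [NormedSpace ℝ W]
    {F : Euc N → W} (hF : Differentiable ℝ F) (z : Euc N) (r : ℝ) (y : Euc N) :
    HasFDerivAt (fun y => F (z + r • y)) (r • fderiv ℝ F (z + r • y)) y := by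
  have h1 : HasFDerivAt (fun y : Euc N => z + r • y) (r • ContinuousLinearMap.id ℝ (Euc N)) y :=
    ((hasFDerivAt_id y).const_smul r).const_add z
  refine ((hF (z + r • y)).hasFDerivAt.comp y h1).congr_fderiv ?_
  ext v
  simp

theorem d2_comp_add_smul {N : ℕ} {F : Euc N → ℝ} (hF : ContDiff ℝ 2 F) (z : Euc N) (r : ℝ)
    (y v : Euc N) : d2 (fun y => F (z + r • y)) y v = r ^ 2 * d2 F (z + r • y) v := by
  have hF1 : ContDiff ℝ 1 (fderiv ℝ F) := hF.fderiv_right (by norm_num)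
  have e1 : fderiv ℝ (fun y => F (z + r • y)) = fun y => r • fderiv ℝ F (z + r • y) :=
    funext fun y => (hasFDerivAt_comp_add_smul (hF.differentiable two_ne_zero) z r y).fderiv
  have e2 := ((hasFDerivAt_comp_add_smul (hF1.differentiable one_ne_zero) z r y).const_smul r).fderiv
  simp only [d2, iteratedFDeriv_two_apply]
  rw [e1, show (fun y => r • fderiv ℝ F (z + r • y)) =
    (r • fun y => fderiv ℝ F (z + r • y)) from rfl, e2]
  simp
  ring

theorem hasDerivAt_integral_bump {N : ℕ} {F : Euc N → ℝ} (hF : ContDiff ℝ 1 F) (z : Euc N)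
    (r : ℝ) :
    HasDerivAt (fun r : ℝ => ∫ y : Euc N, bump y * F (z + r • y))
      (∫ y : Euc N, bump y * fderiv ℝ F (z + r • y) y) r := by
  have hb0 : ∀ y : Euc N, 1 ≤ ‖y‖ → bump y = 0 := fun y hy => by
    rw [bump, max_one_sub_norm_sq_eq_zero hy]; norm_num
  have hF' : Continuous (fderiv ℝ F) := hF.continuous_fderiv one_ne_zero
  obtain ⟨M, hM⟩ := (isCompact_closedBall z (|r| + 1)).exists_bound_of_continuousOn
    hF'.continuousOn
  have hc : ∀ r : ℝ, Continuous fun y : Euc N => bump y * F (z + r • y) := fun r =>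
    continuous_bump.mul (hF.continuous.comp (by fun_prop))
  have hc' : Continuous fun y : Euc N => bump y * fderiv ℝ F (z + r • y) y :=
    continuous_bump.mul ((hF'.comp (by fun_prop)).clm_apply continuous_id)
  refine (hasDerivAt_integral_of_dominated_loc_of_deriv_le (bound := fun y => bump y * M)
    (F := fun (r : ℝ) (y : Euc N) => bump y * F (z + r • y))
    (F' := fun (r : ℝ) (y : Euc N) => bump y * fderiv ℝ F (z + r • y) y)
    (Metric.ball_mem_nhds r one_pos) (Filter.Eventually.of_forall fun r =>
      (hc r).aestronglyMeasurable) ?_ hc'.aestronglyMeasurable ?_ ?_ ?_).2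
  · exact (hc r).integrable_of_hasCompactSupport
      (hasCompactSupport_of_norm fun y hy => by simp [hb0 y hy])
  · refine Filter.Eventually.of_forall fun y ρ hρ => ?_
    rw [norm_mul, Real.norm_of_nonneg (bump_nonneg y)]
    rcases lt_or_ge ‖y‖ 1 with h | h
    · refine mul_le_mul_of_nonneg_left ?_ (bump_nonneg y)
      have hρ' : |ρ| ≤ |r| + 1 := by
        rw [Metric.mem_ball, Real.dist_eq] at hρ
        have := abs_sub_abs_le_abs_sub ρ r
        linarith
      have hin : z + ρ • y ∈ Metric.closedBall z (|r| + 1) := by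
        simp only [Metric.mem_closedBall, dist_self_add_left, norm_smul, Real.norm_eq_abs]
        nlinarith [abs_nonneg ρ, norm_nonneg y]
      have h1 := hM _ hin
      refine (ContinuousLinearMap.le_opNorm _ _).trans ?_
      nlinarith [norm_nonneg (fderiv ℝ F (z + ρ • y)), norm_nonneg y]
    · simp [hb0 y h]
  · exact (continuous_bump.mul continuous_const).integrable_of_hasCompactSupport
      (hasCompactSupport_of_norm fun y hy => by simp [hb0 y hy])
  · refine Filter.Eventually.of_forall fun y ρ _ => ?_
    have h1 : HasDerivAt (fun ρ : ℝ => z + ρ • y) y ρ := by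
      simpa using ((hasDerivAt_id ρ).smul_const y).const_add z
    exact (((hF.differentiable one_ne_zero _).hasFDerivAt.comp_hasDerivAt ρ h1)).const_mul _

/-- The mean value property of harmonic functions for the radial weight. -/
theorem integral_bump_mul_eq {N : ℕ} {F : Euc N → ℝ} (hF : ContDiff ℝ 2 F) (z : Euc N) {R : ℝ}
    (hR : 0 < R)
    (hL : ∀ w ∈ Metric.ball z R, ∑ i, d2 F w (EuclideanSpace.single i 1) = 0) :
    ∫ y : Euc N, bump y * F (z + R • y) = (∫ y : Euc N, bump y) * F z := by
  have hF1 : ContDiff ℝ 1 F := hF.of_le (by norm_num)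
  have hd := fun r => hasDerivAt_integral_bump hF1 z r
  obtain ⟨c, hc, hce⟩ := exists_hasDerivAt_eq_slope _ _ hR
    (fun r _ => (hd r).continuousAt.continuousWithinAt) (fun r _ => hd r)
  have hz : ∫ y : Euc N, bump y * fderiv ℝ F (z + c • y) y = 0 := by
    have hG : ContDiff ℝ 2 (fun y : Euc N => F (z + c • y)) := hF.comp (by fun_prop)
    have h1 := integral_bump_mul_fderiv_eq_zero hG fun y hy => by
      simp_rw [d2_comp_add_smul hF]
      rw [← Finset.mul_sum, hL, mul_zero]
      simp only [Metric.mem_ball, dist_self_add_left, norm_smul, Real.norm_eq_abs,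
        abs_of_pos hc.1]
      nlinarith [hc.1, hc.2, norm_nonneg y]
    simp_rw [(hasFDerivAt_comp_add_smul (hF.differentiable two_ne_zero) z c _).fderiv] at h1
    have h2 : ∀ y : Euc N, bump y * (c • fderiv ℝ F (z + c • y)) y =
        c * (bump y * fderiv ℝ F (z + c • y) y) := fun y => by simp; ring
    simp_rw [h2] at h1
    rw [integral_const_mul] at h1
    exact (mul_eq_zero.mp h1).resolve_left hc.1.ne'
  rw [hz, eq_comm, div_eq_zero_iff] at hce
  have h3 := hce.resolve_right (by linarith)
  simp only [zero_smul, add_zero] at h3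
  rw [integral_mul_const] at h3
  linarith

theorem exists_contDiff_eqOn_ball {N : ℕ} {f : Euc N → ℝ} {U : Set (Euc N)}
    (hf : ContDiffOn ℝ 2 f U) (hU : IsOpen U) {z : Euc N} {r R : ℝ} (hr : 0 < r) (hrR : r < R)
    (hRU : Metric.ball z R ⊆ U) :
    ∃ F : Euc N → ℝ, ContDiff ℝ 2 F ∧ EqOn F f (Metric.ball z r) := by
  let χ : ContDiffBump z := ⟨r, (r + R) / 2, hr, by linarith⟩
  refine ⟨fun w => χ w * f w, contDiff_iff_contDiffAt.mpr fun x => ?_, fun w hw => ?_⟩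
  · by_cases hx : x ∈ tsupport (fun w => χ w * f w)
    swap
    · exact contDiffAt_const.congr_of_eventuallyEq (notMem_tsupport_iff_eventuallyEq.mp hx)
    have h1 : x ∈ tsupport χ := tsupport_mul_subset_left hx
    rw [χ.tsupport_eq] at h1
    have h2 : x ∈ U := hRU (Metric.closedBall_subset_ball
      (show (r + R) / 2 < R by linarith) h1)
    exact χ.contDiffAt.mul (hf.contDiffAt (hU.mem_nhds h2))
  · simp only
    rw [χ.one_of_mem_closedBall (Metric.ball_subset_closedBall hw), one_mul]

theorem abs_mul_le_integral_ball {N : ℕ} {f : Euc N → ℝ} {U : Set (Euc N)}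
    (hf : HarmonicOnE f U) (hU : IsOpen U) {z : Euc N} {r R : ℝ} (hr : 0 < r) (hrR : r < R)
    (hRU : Metric.ball z R ⊆ U) :
    (∫ y : Euc N, bump y) * |f z| * r ^ N ≤ ∫ w in Metric.ball z r, |f w| := by
  obtain ⟨F, hF, hFf⟩ := exists_contDiff_eqOn_ball hf.1 hU hr hrR hRU
  have hb0 : ∀ y : Euc N, 1 ≤ ‖y‖ → bump y = 0 := fun y hy => by
    rw [bump, max_one_sub_norm_sq_eq_zero hy]; norm_num
  have hL : ∀ w ∈ Metric.ball z r, ∑ i, d2 F w (EuclideanSpace.single i 1) = 0 := by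
    intro w hw
    rw [← hf.2 w (hRU (Metric.ball_subset_ball hrR.le hw))]
    refine Finset.sum_congr rfl fun i _ => ?_
    have he : F =ᶠ[nhds w] f := hFf.eventuallyEq_of_mem (Metric.isOpen_ball.mem_nhds hw)
    rw [d2, d2, (he.iteratedFDeriv ℝ 2).eq_of_nhds]
  have hmv := integral_bump_mul_eq hF z hr hL
  have h1 : (∫ y : Euc N, bump y) * |f z| ≤ ∫ y : Euc N, bump y * |F (z + r • y)| := by
    rw [← hFf (Metric.mem_ball_self hr), ← abs_of_pos (integral_bump_pos (N := N)), ← abs_mul,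
      ← hmv]
    refine abs_integral_le_integral_abs.trans_eq ?_
    simp_rw [abs_mul, abs_of_nonneg (bump_nonneg _)]
  have h2 : ∫ y : Euc N, bump y * |F (z + r • y)| ≤
      ∫ y : Euc N, (Metric.ball z r).indicator (fun w => |F w|) (z + r • y) := by
    have hmem : ∀ y : Euc N, z + r • y ∈ Metric.ball z r ↔ ‖y‖ < 1 := fun y => by
      simp only [Metric.mem_ball, dist_self_add_left, norm_smul, Real.norm_eq_abs, abs_of_pos hr]
      constructor <;> intro h <;> nlinarith
    refine integral_mono_of_nonneg (Filter.Eventually.of_forall fun y =>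
      mul_nonneg (bump_nonneg y) (abs_nonneg _)) ?_ (Filter.Eventually.of_forall fun y => ?_)
    · have he : (fun y : Euc N => (Metric.ball z r).indicator (fun w => |F w|) (z + r • y)) =
          (Metric.ball 0 1).indicator (fun y => |F (z + r • y)|) := by
        funext y
        simp only [Set.indicator, hmem, mem_ball_zero_iff]
      rw [he, integrable_indicator_iff Metric.isOpen_ball.measurableSet]
      have hc : Continuous fun y : Euc N => |F (z + r • y)| :=
        (hF.continuous.comp (by fun_prop)).abs
      exact (hc.continuousOn.integrableOn_compact (isCompact_closedBall 0 1)).mono_set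
        Metric.ball_subset_closedBall
    · simp only [Set.indicator, hmem]
      split_ifs with h
      · exact mul_le_of_le_one_left (abs_nonneg _) (bump_le_one y)
      · simp [hb0 y (not_lt.mp h)]
  have h3 : ∫ y : Euc N, (Metric.ball z r).indicator (fun w => |F w|) (z + r • y) =
      (r ^ N)⁻¹ * ∫ w in Metric.ball z r, |f w| := by
    rw [Measure.integral_comp_smul volume
      (fun y => (Metric.ball z r).indicator (fun w => |F w|) (z + y)) r,
      integral_add_left_eq_self (fun y => (Metric.ball z r).indicator (fun w => |F w|) y) z,
      integral_indicator Metric.isOpen_ball.measurableSet, finrank_euclideanSpace_fin,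
      abs_of_pos (by positivity), smul_eq_mul]
    congr 1
    exact setIntegral_congr_fun Metric.isOpen_ball.measurableSet fun w hw => by
      simp only [hFf hw]
  have h4 := h1.trans (h2.trans_eq h3)
  rwa [← div_eq_inv_mul, le_div_iff₀ (by positivity)] at h4

/-- Subharmonic behaviour of `|f|^p` for harmonic `f` and `0 < p ≤ 1`. -/
theorem exists_abs_rpow_mul_le_integral_ball {N : ℕ} (hN : 0 < N) {p : ℝ} (hp0 : 0 < p)
    (hp1 : p ≤ 1) : ∃ C : ℝ, 0 < C ∧ ∀ (f : Euc N → ℝ) (U : Set (Euc N)), HarmonicOnE f U →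
      IsOpen U → ∀ (z : Euc N) (R : ℝ), 0 < R → Metric.closedBall z R ⊆ U →
      |f z| ^ p * R ^ N ≤ C * ∫ w in Metric.ball z R, |f w| ^ p := by
  set I : ℝ := ∫ y : Euc N, bump y with hI
  have hI0 : 0 < I := integral_bump_pos
  have hNp : 0 < (N : ℝ) / p := by positivity
  set L : ℝ := 2 ^ ((N : ℝ) / p) with hLdef
  have hL0 : 0 < L := by positivity
  refine ⟨L ^ (1 - p) * 2 ^ N / I, by positivity, fun f U hf hU z R hR hRU => ?_⟩
  have hA : 0 ≤ ∫ w in Metric.ball z R, |f w| ^ p :=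
    integral_nonneg fun w => Real.rpow_nonneg (abs_nonneg _) _
  by_cases hfz : f z = 0
  · rw [hfz, abs_zero, Real.zero_rpow hp0.ne', zero_mul]
    positivity
  have hfc : ContinuousOn f (Metric.closedBall z R) := hf.1.continuousOn.mono hRU
  have hgc : ContinuousOn (fun w => |f w| * (R - dist w z) ^ ((N : ℝ) / p))
      (Metric.closedBall z R) :=
    hfc.abs.mul (Continuous.continuousOn
      (Continuous.rpow_const (by fun_prop) fun _ => Or.inr hNp.le))
  obtain ⟨w₀, hw₀, hmax⟩ := (isCompact_closedBall z R).exists_isMaxOn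
    ⟨z, Metric.mem_closedBall_self hR.le⟩ hgc
  have hmax' : ∀ w ∈ Metric.closedBall z R, |f w| * (R - dist w z) ^ ((N : ℝ) / p) ≤
      |f w₀| * (R - dist w₀ z) ^ ((N : ℝ) / p) := fun w hw => hmax hw
  set d := R - dist w₀ z with hd
  have hz := hmax' z (Metric.mem_closedBall_self hR.le)
  rw [dist_self, sub_zero] at hz
  have hpos : 0 < |f w₀| * d ^ ((N : ℝ) / p) :=
    lt_of_lt_of_le (mul_pos (abs_pos.mpr hfz) (by positivity)) hz
  have hd0 : 0 < d := by
    have h1 : 0 ≤ d := by simpa [hd] using hw₀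
    rcases h1.eq_or_lt with h | h
    · rw [← h, Real.zero_rpow hNp.ne', mul_zero] at hpos
      exact absurd hpos (lt_irrefl _)
    · exact h
  have hfw : 0 < |f w₀| := pos_of_mul_pos_left hpos (by positivity)
  have hsub : Metric.ball w₀ d ⊆ Metric.ball z R :=
    Metric.ball_subset_ball' (by simp [hd])
  have hsub2 : Metric.ball w₀ (d / 2) ⊆ Metric.ball z R :=
    (Metric.ball_subset_ball (by linarith)).trans hsub
  have hbound : ∀ w ∈ Metric.ball w₀ (d / 2), |f w| ≤ L * |f w₀| := fun w hw => by
    have h1 := hmax' w (Metric.ball_subset_closedBall (hsub2 hw))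
    have h2 : d / 2 ≤ R - dist w z := by
      have := dist_triangle w w₀ z
      rw [Metric.mem_ball] at hw
      linarith
    have h3 : (d / 2) ^ ((N : ℝ) / p) ≤ (R - dist w z) ^ ((N : ℝ) / p) :=
      Real.rpow_le_rpow (by positivity) h2 hNp.le
    rw [Real.div_rpow hd0.le zero_le_two, ← hLdef] at h3
    have h4 := (mul_le_mul_of_nonneg_left h3 (abs_nonneg (f w))).trans h1
    have hdp : 0 < d ^ ((N : ℝ) / p) := by positivity
    rw [mul_div_assoc', div_le_iff₀ hL0] at h4
    nlinarith
  have h_int : ∀ q : ℝ, 0 ≤ q → IntegrableOn (fun w => |f w| ^ q) (Metric.ball z R) :=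
    fun q hq => ((hfc.abs.rpow_const fun _ _ => Or.inr hq).integrableOn_compact
      (isCompact_closedBall z R)).mono_set Metric.ball_subset_closedBall
  have hmv := abs_mul_le_integral_ball hf hU (z := w₀) (r := d / 2) (R := d) (by linarith)
    (by linarith) (hsub.trans (Metric.ball_subset_closedBall.trans hRU))
  have hstep : ∫ w in Metric.ball w₀ (d / 2), |f w| ≤
      (L * |f w₀|) ^ (1 - p) * ∫ w in Metric.ball z R, |f w| ^ p := by
    calc ∫ w in Metric.ball w₀ (d / 2), |f w|
        ≤ ∫ w in Metric.ball w₀ (d / 2), (L * |f w₀|) ^ (1 - p) * |f w| ^ p := by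
          refine setIntegral_mono_on ?_ (((h_int p hp0.le).mono_set hsub2).const_mul _)
            Metric.isOpen_ball.measurableSet fun w hw => ?_
          · simpa using (h_int 1 zero_le_one).mono_set hsub2
          · rcases (abs_nonneg (f w)).eq_or_lt with h | h
            · rw [← h]; positivity
            · calc |f w| = |f w| ^ (1 - p) * |f w| ^ p := by
                    rw [← Real.rpow_add h]; simp
                _ ≤ _ := mul_le_mul_of_nonneg_right
                    (Real.rpow_le_rpow h.le (hbound w hw) (by linarith)) (by positivity)
      _ = (L * |f w₀|) ^ (1 - p) * ∫ w in Metric.ball w₀ (d / 2), |f w| ^ p :=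
          integral_const_mul _ _
      _ ≤ _ := by
          refine mul_le_mul_of_nonneg_left (setIntegral_mono_set (h_int p hp0.le)
            (Filter.Eventually.of_forall fun w => Real.rpow_nonneg (abs_nonneg _) _)
            hsub2.eventuallyLE) (by positivity)
  have hfin := hmv.trans hstep
  rw [Real.mul_rpow hL0.le hfw.le, div_pow, ← hI] at hfin
  have hsplit : |f w₀| = |f w₀| ^ p * |f w₀| ^ (1 - p) := by
    rw [← Real.rpow_add hfw]; simp
  have hq : 0 < |f w₀| ^ (1 - p) := by positivity
  set A := ∫ w in Metric.ball z R, |f w| ^ p with hAdef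
  have hfin2 : |f w₀| ^ p * d ^ N ≤ L ^ (1 - p) * 2 ^ N / I * A := by
    have h5 : |f w₀| ^ (1 - p) * (I * (|f w₀| ^ p * d ^ N) / 2 ^ N) ≤
        |f w₀| ^ (1 - p) * (L ^ (1 - p) * A) := by
      calc _ = I * (|f w₀| ^ p * |f w₀| ^ (1 - p)) * (d ^ N / 2 ^ N) := by ring
        _ = I * |f w₀| * (d ^ N / 2 ^ N) := by rw [← hsplit]
        _ ≤ _ := hfin
        _ = _ := by ring
    have h6 := le_of_mul_le_mul_left h5 hq
    rw [div_le_iff₀ (by positivity)] at h6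
    rw [div_mul_eq_mul_div, le_div_iff₀ hI0]
    linarith
  refine le_trans ?_ hfin2
  have e : ∀ a b : ℝ, 0 ≤ a → 0 ≤ b → (a * b ^ ((N : ℝ) / p)) ^ p = a ^ p * b ^ N := by
    intro a b ha hb
    rw [Real.mul_rpow ha (by positivity), ← Real.rpow_mul hb, div_mul_cancel₀ _ hp0.ne',
      Real.rpow_natCast]
  rw [← e _ _ (abs_nonneg _) hR.le, ← e _ _ hfw.le hd0.le]
  exact Real.rpow_le_rpow (by positivity) hz hp0.le

theorem ofReal_integral_le_lintegral_ofReal {α : Type*} [MeasurableSpace α] {μ : Measure α}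
    {h : α → ℝ} (h0 : ∀ a, 0 ≤ h a) :
    ENNReal.ofReal (∫ a, h a ∂μ) ≤ ∫⁻ a, ENNReal.ofReal (h a) ∂μ := by
  by_cases hi : Integrable h μ
  · rw [ofReal_integral_eq_lintegral_ofReal hi (Filter.Eventually.of_forall h0)]
  · simp [integral_undef hi]

@[simp] theorem xp_pt {n : ℕ} (x : Euc n) (t : ℝ) : xp (pt x t) = x := by
  ext i; simp [xp, pt]

theorem pt_xp_tp {n : ℕ} (v : Euc (n + 1)) : pt (xp v) (tp v) = v := by
  ext i
  refine Fin.lastCases ?_ (fun j => ?_) i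
  · simp [pt, tp]
  · simp [pt, xp]

theorem dB_le_dB_add_dist {n : ℕ} (x : Euc n) (t : ℝ) (v w : Euc (n + 1)) :
    dB x t (xp w) (tp w) ≤ dB x t (xp v) (tp v) + dist w v := by
  have h1 : dist (pt (xp v) (-tp v)) (pt (xp w) (-tp w)) = dist w v := by
    have e1 : dist (pt (xp v) (-tp v)) (pt (xp w) (-tp w)) = dB (xp v) (-tp v) (xp w) (tp w) := rfl
    have e2 : dist w v = dB (xp w) (tp w) (xp v) (-tp v) := by
      rw [dB, neg_neg, pt_xp_tp, pt_xp_tp]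
    rw [e1, e2, ← sq_eq_sq₀ (dB_nonneg ..) (dB_nonneg ..), dB_sq, dB_sq, norm_sub_rev]
    ring
  rw [← h1]
  exact dist_triangle _ _ _

theorem abs_tp_sub_le {n : ℕ} (v w : Euc (n + 1)) : |tp w - tp v| ≤ dist w v := by
  rw [dist_eq_norm, ← Real.norm_eq_abs]
  exact PiLp.norm_apply_le (w - v) (Fin.last n)

theorem rpow_le_two_rpow_abs_mul {s s' : ℝ} (hs : 0 < s) (hs' : 0 < s') (h1 : s ≤ 2 * s')
    (h2 : s' ≤ 2 * s) (e : ℝ) : s ^ e ≤ 2 ^ |e| * s' ^ e := by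
  rcases le_total 0 e with h | h
  · rw [abs_of_nonneg h, ← Real.mul_rpow zero_le_two hs'.le]
    exact Real.rpow_le_rpow hs.le h1 h
  · rw [abs_of_nonpos h]
    have h3 : (2 * s) ^ e ≤ s' ^ e := Real.rpow_le_rpow_of_nonpos hs' h2 h
    rw [Real.mul_rpow zero_le_two hs.le] at h3
    calc s ^ e = 2 ^ (-e) * (2 ^ e * s ^ e) := by
          rw [← mul_assoc, ← Real.rpow_add two_pos]; simp
      _ ≤ _ := mul_le_mul_of_nonneg_left h3 (by positivity)

/-- Pointwise control of the weighted density `|f|^p s^e |z - w̄|^(-q)` by its integral. -/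
theorem exists_weighted_pointwise_le (n : ℕ) {p : ℝ} (hp0 : 0 < p) (hp1 : p ≤ 1) (e q : ℝ)
    (hq : 0 ≤ q) : ∃ K : ℝ, 0 < K ∧ ∀ f : Euc (n + 1) → ℝ, HarmonicOnE f (upperHS n) →
      ∀ (x : Euc n) (t : ℝ), 0 < t → ∀ v ∈ upperHS n,
      ENNReal.ofReal (|f v| ^ p * tp v ^ e * dB x t (xp v) (tp v) ^ (-q) * tp v ^ (n + 1)) ≤
        ENNReal.ofReal K * ∫⁻ w in upperHS n,
          ENNReal.ofReal (|f w| ^ p * tp w ^ e * dB x t (xp w) (tp w) ^ (-q)) := by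
  obtain ⟨C, hC, h⟩ := exists_abs_rpow_mul_le_integral_ball (N := n + 1) n.add_one_pos hp0 hp1
  refine ⟨2 ^ (n + 1) * C * (2 ^ |e| * 2 ^ q), by positivity, fun f hf x t ht v hv => ?_⟩
  set s := tp v with hs
  have hs0 : 0 < s := hv
  have htp : ∀ w ∈ Metric.closedBall v (s / 2), s / 2 ≤ tp w ∧ tp w ≤ 3 * s / 2 := fun w hw => by
    have h1 := abs_le.mp ((abs_tp_sub_le v w).trans hw)
    constructor <;> linarith [h1.1, h1.2]
  have hsub : Metric.closedBall v (s / 2) ⊆ upperHS n := fun w hw => by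
    have := (htp w hw).1
    show 0 < tp w
    linarith
  have hHL := h f _ hf (isOpen_upperHS n) v (s / 2) (by positivity) hsub
  set D := dB x t (xp v) s with hD
  have hD0 : t + s ≤ D := add_le_dB ..
  have hDp : 0 < D := by linarith
  set k : ℝ := s ^ e * D ^ (-q) with hk
  have hk0 : 0 < k := by positivity
  have hb0 : Metric.ball v (s / 2) ⊆ upperHS n := Metric.ball_subset_closedBall.trans hsub
  have hcomp : ∀ w ∈ Metric.ball v (s / 2), k * |f w| ^ p ≤
      2 ^ |e| * 2 ^ q * (|f w| ^ p * tp w ^ e * dB x t (xp w) (tp w) ^ (-q)) := fun w hw => by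
    obtain ⟨h1, h2⟩ := htp w (Metric.ball_subset_closedBall hw)
    have hw0 : 0 < tp w := hb0 hw
    have h3 := rpow_le_two_rpow_abs_mul hs0 hw0 (by linarith) (by linarith) e
    have hD' : dB x t (xp w) (tp w) ≤ 2 * D := by
      have := dB_le_dB_add_dist x t v w
      rw [Metric.mem_ball] at hw
      linarith
    have hDw : 0 < dB x t (xp w) (tp w) := by
      have := add_le_dB x t (xp w) (tp w)
      linarith
    have h4 : D ^ (-q) ≤ 2 ^ q * dB x t (xp w) (tp w) ^ (-q) := by
      have h5 := Real.rpow_le_rpow_of_nonpos hDw hD' (neg_nonpos.mpr hq)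
      rw [Real.mul_rpow zero_le_two hDp.le] at h5
      calc D ^ (-q) = 2 ^ q * (2 ^ (-q) * D ^ (-q)) := by
            rw [← mul_assoc, ← Real.rpow_add two_pos]; simp
        _ ≤ _ := mul_le_mul_of_nonneg_left h5 (by positivity)
    have h6 := mul_le_mul h3 h4 (by positivity) (by positivity)
    have h7 := mul_le_mul_of_nonneg_right h6 (Real.rpow_nonneg (abs_nonneg (f w)) p)
    refine h7.trans_eq ?_
    ring
  have hreal : |f v| ^ p * s ^ e * D ^ (-q) * s ^ (n + 1) ≤
      2 ^ (n + 1) * C * ∫ w in Metric.ball v (s / 2), k * |f w| ^ p := by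
    rw [integral_const_mul]
    rw [div_pow, mul_div_assoc', div_le_iff₀ (by positivity)] at hHL
    have := mul_le_mul_of_nonneg_left hHL hk0.le
    calc _ = k * (|f v| ^ p * s ^ (n + 1)) := by rw [hk]; ring
      _ ≤ _ := this
      _ = _ := by ring
  refine (ENNReal.ofReal_le_ofReal hreal).trans ?_
  rw [ENNReal.ofReal_mul (by positivity), ENNReal.ofReal_mul (p := 2 ^ (n + 1) * C) (by positivity),
    mul_assoc]
  refine mul_le_mul_right ?_ _
  refine (ofReal_integral_le_lintegral_ofReal fun w => by positivity).trans ?_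
  rw [← lintegral_const_mul' _ _ ENNReal.ofReal_ne_top]
  refine (setLIntegral_mono' Metric.isOpen_ball.measurableSet fun w hw => ?_).trans
    (lintegral_mono_set hb0)
  rw [← ENNReal.ofReal_mul (by positivity)]
  exact ENNReal.ofReal_le_ofReal (hcomp w hw)

/-- the pointwise kernel estimate for harmonic functions, 0 < p ≤ 1. -/
theorem stmt15 (n : ℕ) (hn : 1 ≤ n) (p : ℝ) (hp0 : 0 < p) (hp1 : p ≤ 1) (m : ℕ) :
    ∃ C : ℝ, 0 < C ∧ ∀ f : Euc (n + 1) → ℝ, HarmonicOnE f (upperHS n) →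
      ∀ (x : Euc n) (t : ℝ), 0 < t →
      (∫⁻ w : Euc n × ℝ,
          ENNReal.ofReal (|f (pt w.1 w.2)| * |Qker n m x t w.1 w.2| * w.2 ^ (m : ℝ))
          ∂(baseM n)) ^ p ≤
        ENNReal.ofReal C *
          ∫⁻ w : Euc n × ℝ,
            ENNReal.ofReal (|f (pt w.1 w.2)| ^ p *
              w.2 ^ ((m : ℝ) * p + ((n : ℝ) + 1) * (p - 1)) *
              dB x t w.1 w.2 ^ (-(p * ((m : ℝ) + (n : ℝ) + 1))))
            ∂(baseM n) := by
  obtain ⟨C₁, hC₁, hQ⟩ := exists_abs_Qker_le n m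
  set e : ℝ := (m : ℝ) * p + ((n : ℝ) + 1) * (p - 1) with he
  set q : ℝ := p * ((m : ℝ) + (n : ℝ) + 1) with hq
  obtain ⟨K, hK, hpw⟩ := exists_weighted_pointwise_le n hp0 hp1 e q (by positivity)
  refine ⟨C₁ ^ p * K ^ (1 - p), by positivity, fun f hf x t ht => ?_⟩
  have hL := lintegral_baseM n fun v =>
    ENNReal.ofReal (|f v| * |Qker n m x t (xp v) (tp v)| * tp v ^ (m : ℝ))
  have hR := lintegral_baseM n fun v =>
    ENNReal.ofReal (|f v| ^ p * tp v ^ e * dB x t (xp v) (tp v) ^ (-q))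
  simp only [xp_pt, tp_pt] at hL hR
  rw [hL, hR]
  set A := ∫⁻ v in upperHS n,
    ENNReal.ofReal (|f v| ^ p * tp v ^ e * dB x t (xp v) (tp v) ^ (-q)) with hA
  rcases eq_or_ne A ⊤ with hAt | hAt
  · rw [hAt, ENNReal.mul_top]
    · exact le_top
    · exact (ENNReal.ofReal_pos.mpr (by positivity)).ne'
  set a := A.toReal with ha
  have hAa : A = ENNReal.ofReal a := (ENNReal.ofReal_toReal hAt).symm
  have ha0 : 0 ≤ a := ENNReal.toReal_nonneg
  have hp' : 0 ≤ (1 - p) / p := div_nonneg (by linarith) hp0.le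
  have hpoint : ∀ v ∈ upperHS n, |f v| * |Qker n m x t (xp v) (tp v)| * tp v ^ (m : ℝ) ≤
      C₁ * (K * a) ^ ((1 - p) / p) *
        (|f v| ^ p * tp v ^ e * dB x t (xp v) (tp v) ^ (-q)) := fun v hv => by
    have h1 := hpw f hf x t ht v hv
    rw [← hA, hAa, ← ENNReal.ofReal_mul hK.le,
      ENNReal.ofReal_le_ofReal_iff (by positivity)] at h1
    have hs : 0 < tp v := hv
    have h2 := hQ x t (xp v) (tp v) ht hs
    have hD : 0 < dB x t (xp v) (tp v) := by
      have := add_le_dB x t (xp v) (tp v)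
      linarith
    generalize dB x t (xp v) (tp v) = D at h1 h2 hD ⊢
    generalize tp v = s at h1 h2 hs ⊢
    rcases (abs_nonneg (f v)).eq_or_lt with h0 | h0
    · rw [← h0, Real.zero_rpow hp0.ne']
      simp
    set F := |f v| * s ^ (m : ℝ) * D ^ (-((m : ℝ) + n + 1)) with hF
    have hF0 : 0 < F := by positivity
    have hFp : F ^ p = |f v| ^ p * s ^ ((m : ℝ) * p) * D ^ (-q) := by
      rw [hF, Real.mul_rpow (by positivity) (by positivity), Real.mul_rpow (by positivity)
        (by positivity), ← Real.rpow_mul hs.le, ← Real.rpow_mul hD.le]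
      congr 2
      rw [hq]; ring
    have hFs : (F * s ^ (n + 1)) ^ p = |f v| ^ p * s ^ e * D ^ (-q) * s ^ (n + 1) := by
      rw [Real.mul_rpow hF0.le (by positivity), hFp, ← Real.rpow_natCast s (n + 1),
        ← Real.rpow_mul hs.le]
      have : s ^ ((m : ℝ) * p) * s ^ (((n + 1 : ℕ) : ℝ) * p) = s ^ e * s ^ ((n + 1 : ℕ) : ℝ) := by
        rw [← Real.rpow_add hs, ← Real.rpow_add hs]
        congr 1
        rw [he]; push_cast; ring
      linear_combination (|f v| ^ p * D ^ (-q)) * this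
    rw [← hFs] at h1
    have h3 : (F * s ^ (n + 1)) ^ (1 - p) ≤ (K * a) ^ ((1 - p) / p) := by
      have := Real.rpow_le_rpow (by positivity) h1 hp'
      rwa [← Real.rpow_mul (by positivity), mul_div_cancel₀ _ hp0.ne'] at this
    have h4 : F = (F * s ^ (n + 1)) ^ (1 - p) * (|f v| ^ p * s ^ e * D ^ (-q)) := by
      have e1 : |f v| ^ p * s ^ e * D ^ (-q) = (F * s ^ (n + 1)) ^ p / s ^ (n + 1) := by
        rw [hFs, mul_div_cancel_right₀ _ (by positivity)]
      rw [e1, mul_div_assoc', ← Real.rpow_add (by positivity), sub_add_cancel, Real.rpow_one,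
        mul_div_cancel_right₀ _ (by positivity)]
    calc |f v| * |Qker n m x t (xp v) s| * s ^ (m : ℝ)
        ≤ |f v| * (C₁ * D ^ (-((m : ℝ) + n + 1))) * s ^ (m : ℝ) := by gcongr
      _ = C₁ * F := by rw [hF]; ring
      _ = C₁ * (F * s ^ (n + 1)) ^ (1 - p) * (|f v| ^ p * s ^ e * D ^ (-q)) := by
          rw [mul_assoc, ← h4]
      _ ≤ _ := by gcongr
  have hB : 0 ≤ C₁ * (K * a) ^ ((1 - p) / p) := by positivity
  have h_int : ∫⁻ v in upperHS n,
      ENNReal.ofReal (|f v| * |Qker n m x t (xp v) (tp v)| * tp v ^ (m : ℝ)) ≤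
      ENNReal.ofReal (C₁ * (K * a) ^ ((1 - p) / p)) * A := by
    rw [hA, ← lintegral_const_mul' _ _ ENNReal.ofReal_ne_top]
    refine setLIntegral_mono' (isOpen_upperHS n).measurableSet fun v hv => ?_
    rw [← ENNReal.ofReal_mul hB]
    exact ENNReal.ofReal_le_ofReal (hpoint v hv)
  refine (ENNReal.rpow_le_rpow h_int hp0.le).trans ?_
  rw [hAa, ← ENNReal.ofReal_mul hB, ENNReal.ofReal_rpow_of_nonneg (by positivity) hp0.le,
    ← ENNReal.ofReal_mul (by positivity)]
  refine ENNReal.ofReal_le_ofReal (le_of_eq ?_)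
  have e2 : a ^ (1 - p) * a ^ p = a := by
    rw [← Real.rpow_add_of_nonneg ha0 (by linarith) hp0.le]
    simp
  rw [Real.mul_rpow hB ha0, Real.mul_rpow hC₁.le (by positivity),
    ← Real.rpow_mul (by positivity), div_mul_cancel₀ _ hp0.ne', Real.mul_rpow hK.le ha0]
  linear_combination (C₁ ^ p * K ^ (1 - p)) * e2

end
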